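/- Let q ≥ 1 with Hölder conjugate p (1/p + 1/q = 1, with p = ∞ when q = 1), let R_1,…,R_n ∈ ℝ^d, let δ > 0 and ᾱ ∈ ℝ, and define the feasible region F_{δ,ᾱ}(n) = { φ ∈ ℝ^d : Σ_{i=1}^d φ_i = 1 and E_{P_n}[⟨φ,R⟩] ≥ ᾱ + √δ ‖φ‖_p }. Then the distributionally robust problem min_{φ ∈ F_{δ,ᾱ}(n)} sup_{P : D_c(P,P_n) ≤ δ} Var_P(⟨φ,R⟩) and the regularized empirical problem min_{φ ∈ F_{δ,ᾱ}(n)} ( √( Var_{P_n}(⟨φ,R⟩) ) + √δ ‖φ‖_p )² have the same optimal value, and a vector φ ∈ F_{δ,ᾱ}(n) is optimal for the first problem if and only if it is optimal for the second. -/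

import Mathlib

open MeasureTheory ENNReal NNReal Filter Topology

noncomputable section

/-- The `l_p` norm on `ℝ^d`, for an extended exponent `p` (sup-norm when `p = ∞`). -/
def lpNorm {d : ℕ} (p : ℝ≥0∞) (x : Fin d → ℝ) : ℝ :=
  if p = ∞ then ⨆ i, |x i| else (∑ i, |x i| ^ p.toReal) ^ (1 / p.toReal)

/-- `p ∈ [1,∞]` is the Hölder conjugate of `q ∈ [1,∞)`: `1/p + 1/q = 1`,
with `p = ∞` when `q = 1`. -/
def HolderConjugate (q : ℝ) (p : ℝ≥0∞) : Prop :=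
  (q = 1 ∧ p = ∞) ∨ (1 < q ∧ p ≠ ∞ ∧ 1 / p.toReal + 1 / q = 1)

/-- The optimal transport discrepancy between two Borel probability measures on `ℝ^d`
associated with a cost function `c`. -/
def Dc {d : ℕ} (c : (Fin d → ℝ) → (Fin d → ℝ) → ℝ≥0∞)
    (P Q : Measure (Fin d → ℝ)) : ℝ≥0∞ :=
  ⨅ (π : Measure ((Fin d → ℝ) × (Fin d → ℝ))) (_ : IsProbabilityMeasure π)
    (_ : π.map Prod.fst = P) (_ : π.map Prod.snd = Q), ∫⁻ x, c x.1 x.2 ∂π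

/-- The quadratic `l_q` transport cost `c(u,w) = ‖u - w‖_q²`. -/
def costQ {d : ℕ} (q : ℝ) (u w : Fin d → ℝ) : ℝ≥0∞ :=
  ENNReal.ofReal (lpNorm (ENNReal.ofReal q) (u - w) ^ 2)

/-- The empirical measure `P_n = (1/n) ∑_{i=1}^n δ_{R_i}`. -/
def empMeasure {d n : ℕ} (R : Fin n → Fin d → ℝ) : Measure (Fin d → ℝ) :=
  (n : ℝ≥0∞)⁻¹ • ∑ i : Fin n, Measure.dirac (R i)

/-- Weak convergence of a sequence of measures, expressed via integration of
bounded continuous functions. -/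
def WeakConv {E : Type*} [TopologicalSpace E] [MeasurableSpace E]
    (μs : ℕ → Measure E) (ν : Measure E) : Prop :=
  ∀ f : BoundedContinuousFunction E ℝ,
    Tendsto (fun n => ∫ x, f x ∂(μs n)) atTop (𝓝 (∫ x, f x ∂ν))

section Covariance

variable {Ω : Type*} [MeasurableSpace Ω] {μ : Measure Ω} [IsProbabilityMeasure μ] {X Y : Ω → ℝ}

open ProbabilityTheory

lemma covariance_sq_le_variance_mul_variance (hX : MemLp X 2 μ) (hY : MemLp Y 2 μ) :
    covariance X Y μ ^ 2 ≤ variance X μ * variance Y μ := by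
  have key : ∀ t : ℝ, 0 ≤ variance X μ * (t * t) + 2 * covariance X Y μ * t + variance Y μ := by
    intro t
    have h := variance_nonneg (t • X + Y) μ
    rw [variance_add (hX.const_smul t) hY, variance_smul, covariance_smul_left] at h
    linarith
  have := discrim_le_zero key
  unfold discrim at this
  nlinarith

lemma variance_add_le_sq_sqrt_add_sqrt (hX : MemLp X 2 μ) (hY : MemLp Y 2 μ) :
    variance (X + Y) μ ≤ (√(variance X μ) + √(variance Y μ)) ^ 2 := by
  have h1 := Real.sq_sqrt (variance_nonneg X μ)
  have h2 := Real.sq_sqrt (variance_nonneg Y μ)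
  have h3 : covariance X Y μ ≤ √(variance X μ) * √(variance Y μ) := by
    rw [← Real.sqrt_mul (variance_nonneg X μ)]
    exact Real.le_sqrt_of_sq_le (covariance_sq_le_variance_mul_variance hX hY)
  rw [variance_add hX hY]
  nlinarith

end Covariance

section Duality

variable {d : ℕ} {q : ℝ} {p : ℝ≥0∞}

lemma lpNorm_nonneg (p : ℝ≥0∞) (x : Fin d → ℝ) : 0 ≤ lpNorm p x := by
  unfold _root_.lpNorm
  split_ifs
  · exact Real.iSup_nonneg fun i => abs_nonneg _
  · positivity

lemma lpNorm_ofReal (hq : 0 ≤ q) (x : Fin d → ℝ) :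
    lpNorm (ENNReal.ofReal q) x = (∑ i, |x i| ^ q) ^ (1 / q) := by
  simp [_root_.lpNorm, ENNReal.toReal_ofReal hq]

lemma lpNorm_smul (hq : 0 < q) (t : ℝ) (x : Fin d → ℝ) :
    lpNorm (ENNReal.ofReal q) (t • x) = |t| * lpNorm (ENNReal.ofReal q) x := by
  rw [lpNorm_ofReal hq.le, lpNorm_ofReal hq.le]
  simp only [Pi.smul_apply, smul_eq_mul, abs_mul]
  simp_rw [Real.mul_rpow (abs_nonneg _) (abs_nonneg _)]
  rw [← Finset.mul_sum, Real.mul_rpow (by positivity) (by positivity), ← Real.rpow_mul (abs_nonneg t),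
    mul_one_div_cancel hq.ne', Real.rpow_one]

lemma HolderConjugate.real (h : 1 < q) (hpq : 1 / p.toReal + 1 / q = 1) :
    p.toReal.HolderConjugate q := by
  refine Real.HolderConjugate.symm ((Real.holderConjugate_iff).2 ⟨h, ?_⟩)
  simpa [add_comm] using hpq

lemma HolderConjugate.abs_sum_mul_le (hpq : HolderConjugate q p) (φ x : Fin d → ℝ) :
    |∑ i, φ i * x i| ≤ lpNorm p φ * lpNorm (ENNReal.ofReal q) x := by
  rcases hpq with ⟨rfl, rfl⟩ | ⟨hq, hp, hpq⟩
  · rw [lpNorm_ofReal zero_le_one]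
    simp only [_root_.lpNorm, if_true, Real.rpow_one, div_one]
    rw [Finset.mul_sum]
    refine (Finset.abs_sum_le_sum_abs _ _).trans (Finset.sum_le_sum fun i _ => ?_)
    rw [abs_mul]
    gcongr
    exact le_ciSup (f := fun i => |φ i|) (Set.finite_range _).bddAbove i
  · rw [lpNorm_ofReal (by linarith), _root_.lpNorm, if_neg hp]
    refine (Finset.abs_sum_le_sum_abs _ _).trans ?_
    simp_rw [abs_mul]
    simpa using Real.inner_le_Lp_mul_Lq Finset.univ (fun i => |φ i|) (fun i => |x i|)
      (HolderConjugate.real hq hpq)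

lemma HolderConjugate.exists_sum_mul_eq_lpNorm [Nonempty (Fin d)] (hpq : HolderConjugate q p)
    (φ : Fin d → ℝ) :
    ∃ v : Fin d → ℝ, lpNorm (ENNReal.ofReal q) v ≤ 1 ∧ ∑ i, φ i * v i = lpNorm p φ := by
  rcases hpq with ⟨rfl, rfl⟩ | ⟨hq, hp, hpq⟩
  · obtain ⟨j, hj⟩ := exists_eq_ciSup_of_finite (f := fun i => |φ i|)
    refine ⟨Pi.single j (SignType.sign (φ j) : ℝ), ?_, ?_⟩
    · rw [lpNorm_ofReal zero_le_one]
      simp only [Real.rpow_one, div_one]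
      rw [Finset.sum_eq_single j (by intro b _ hb; simp [hb]) (by simp)]
      rcases lt_trichotomy (φ j) 0 with h | h | h <;> simp [h]
    · simp only [_root_.lpNorm, if_true]
      rw [Finset.sum_eq_single j (by intro b _ hb; simp [hb]) (by simp), ← hj]
      simp [self_mul_sign]
  · obtain ⟨⟨w, hw, hsum⟩, -⟩ := NNReal.isGreatest_Lp Finset.univ (fun i => ‖φ i‖₊)
      (HolderConjugate.real hq hpq)
    simp only [Set.mem_ofPred_eq] at hw hsum
    have hw' : ∑ i, (w i : ℝ) ^ q ≤ 1 := by exact_mod_cast hw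
    refine ⟨fun i => SignType.sign (φ i) * w i, ?_, ?_⟩
    · rw [lpNorm_ofReal (by linarith)]
      refine Real.rpow_le_one (by positivity) (le_trans (Finset.sum_le_sum fun i _ => ?_) hw')
        (by positivity)
      refine Real.rpow_le_rpow (abs_nonneg _) ?_ (by linarith)
      rcases lt_trichotomy (φ i) 0 with h | h | h <;> simp [h]
    · have h := congrArg NNReal.toReal hsum
      push_cast at h
      rw [_root_.lpNorm, if_neg hp]
      simpa [← mul_assoc, self_mul_sign] using h

end Duality

section UniformDirac

variable {ι E F : Type*} [Fintype ι] [MeasurableSpace E] [MeasurableSpace F]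

/-- The uniform distribution on a finite family of points, counted with multiplicity. -/
def uniformDirac (x : ι → E) : Measure E :=
  (Fintype.card ι : ℝ≥0∞)⁻¹ • ∑ i, Measure.dirac (x i)

lemma empMeasure_eq_uniformDirac {d n : ℕ} (R : Fin n → Fin d → ℝ) :
    empMeasure R = uniformDirac R := by
  simp [empMeasure, uniformDirac]

instance [Nonempty ι] (x : ι → E) : IsProbabilityMeasure (uniformDirac x) := by
  constructor
  simp [uniformDirac, ENNReal.inv_mul_cancel]

lemma map_uniformDirac (x : ι → E) {f : E → F} (hf : Measurable f) :
    (uniformDirac x).map f = uniformDirac (f ∘ x) := by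
  ext s hs
  rw [Measure.map_apply hf hs]
  simp [uniformDirac, hs, hf hs]
  rfl

lemma uniformDirac_comp_fst {κ : Type*} [Fintype κ] [Nonempty κ] (x : ι → E) :
    uniformDirac (fun k : ι × κ => x k.1) = uniformDirac x := by
  have h : (Fintype.card κ : ℝ≥0∞) ≠ 0 := by simp
  ext s hs
  simp [uniformDirac, Fintype.sum_prod_type, ← Finset.mul_sum]
  rw [ENNReal.mul_inv (by simp) (by simp), mul_assoc, ← mul_assoc _ (Fintype.card κ : ℝ≥0∞),
    ENNReal.inv_mul_cancel h (by simp), one_mul]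

variable [MeasurableSingletonClass E]

lemma integrable_uniformDirac [Nonempty ι] (x : ι → E) (f : E → ℝ) :
    Integrable f (uniformDirac x) := by
  refine Integrable.smul_measure ?_ (by simp)
  exact integrable_finsetSum_measure.2 fun i _ => integrable_dirac (by simp)

lemma integral_uniformDirac (x : ι → E) (f : E → ℝ) :
    ∫ r, f r ∂(uniformDirac x) = (Fintype.card ι : ℝ)⁻¹ * ∑ i, f (x i) := by
  rw [uniformDirac, integral_smul_measure, integral_finsetSum_measure
    fun i _ => integrable_dirac (by simp)]
  simp

lemma lintegral_uniformDirac (x : ι → E) (f : E → ℝ≥0∞) :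
    ∫⁻ r, f r ∂(uniformDirac x) = (Fintype.card ι : ℝ≥0∞)⁻¹ * ∑ i, f (x i) := by
  simp [uniformDirac]

end UniformDirac

lemma sum_prod_bool_fst {ι : Type*} [Fintype ι] (f : ι → ℝ) :
    ∑ k : ι × Bool, f k.1 = 2 * ∑ i, f i := by
  simp [Fintype.sum_prod_type, Finset.mul_sum, two_mul]

lemma exists_perfectly_correlated {ι : Type*} [Fintype ι] [Nonempty ι] (y : ι → ℝ) {δ : ℝ}
    (hδ : 0 ≤ δ) :
    ∃ t : ι × Bool → ℝ, ∑ k, t k = 0 ∧ ∑ k, t k ^ 2 = 2 * Fintype.card ι * δ ∧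
      ∑ k, t k * y k.1 = 2 * Fintype.card ι * (√δ *
        √((Fintype.card ι : ℝ)⁻¹ * (∑ i, y i ^ 2) - ((Fintype.card ι : ℝ)⁻¹ * ∑ i, y i) ^ 2)) := by
  set n : ℝ := (Fintype.card ι : ℝ) with hn
  have hn0 : n ≠ 0 := by simp [hn]
  have hnpos : 0 < n := by simp [hn, Fintype.card_pos]
  set M : ℝ := n⁻¹ * ∑ i, y i with hM
  set S : ℝ := n⁻¹ * (∑ i, y i ^ 2) - M ^ 2 with hS
  have hy : ∑ i, y i = n * M := by rw [hM]; field_simp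
  have hy2 : ∑ i, y i ^ 2 = n * (S + M ^ 2) := by rw [hS]; field_simp; ring
  have hc : ∑ i, (y i - M) = 0 := by simp [Finset.sum_sub_distrib, hy, hn]
  have hc2 : ∑ i, (y i - M) ^ 2 = n * S := by
    have : ∀ i, (y i - M) ^ 2 = y i ^ 2 - 2 * M * y i + M ^ 2 := fun i => by ring
    simp_rw [this, Finset.sum_add_distrib, Finset.sum_sub_distrib, ← Finset.mul_sum, hy, hy2]
    simp [← hn]; ring
  have hcy : ∑ i, (y i - M) * y i = n * S := by
    have : ∀ i, (y i - M) * y i = y i ^ 2 - M * y i := fun i => by ring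
    simp_rw [this, Finset.sum_sub_distrib, ← Finset.mul_sum, hy, hy2]
    ring
  have hS0 : 0 ≤ S := nonneg_of_mul_nonneg_right
    (hc2 ▸ Finset.sum_nonneg fun i _ => sq_nonneg _) hnpos
  rcases hS0.eq_or_lt with h0 | hpos
  · refine ⟨fun k => if k.2 then √δ else -√δ, ?_, ?_, ?_⟩
    · simp [Fintype.sum_prod_type]
    · have hk : ∀ k : ι × Bool, (if k.2 then √δ else -√δ) ^ 2 = δ := by
        intro k
        split_ifs <;> simp [Real.sq_sqrt hδ]
      simp only [hk, Finset.sum_const, Finset.card_univ, Fintype.card_prod, Fintype.card_bool,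
        nsmul_eq_mul, Nat.cast_mul, Nat.cast_ofNat, ← hn]
      ring
    · simp [Fintype.sum_prod_type, ← h0]
  · have hs : √S ≠ 0 := (Real.sqrt_pos.2 hpos).ne'
    refine ⟨fun k => √δ / √S * (y k.1 - M), ?_, ?_, ?_⟩
    · rw [← Finset.mul_sum, sum_prod_bool_fst (fun i => y i - M), hc, mul_zero, mul_zero]
    · simp only [mul_pow, ← Finset.mul_sum]
      rw [sum_prod_bool_fst (fun i => (y i - M) ^ 2), hc2, div_pow, Real.sq_sqrt hδ,
        Real.sq_sqrt hS0]
      field_simp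
    · simp only [mul_assoc, ← Finset.mul_sum]
      rw [sum_prod_bool_fst (fun i => (y i - M) * y i), hcy]
      field_simp
      rw [Real.sq_sqrt hS0]

section WorstCaseVariance

open ProbabilityTheory

variable {d n : ℕ} {q : ℝ} {p : ℝ≥0∞}

lemma memLp_two_sum_mul {P : Measure (Fin d → ℝ)} (hP : Integrable (fun r => ‖r‖ ^ 2) P)
    (φ : Fin d → ℝ) : MemLp (fun r : Fin d → ℝ => ∑ i, φ i * r i) 2 P := by
  have hid : MemLp (fun r : Fin d → ℝ => r) 2 P :=
    (memLp_two_iff_integrable_sq_norm aestronglyMeasurable_id).2 hP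
  exact memLp_finsetSum _ fun i _ => ((memLp_pi_iff.1 hid) i).const_mul (φ i)

lemma HolderConjugate.integral_sq_le (hpq : HolderConjugate q p) (φ : Fin d → ℝ)
    {π : Measure ((Fin d → ℝ) × (Fin d → ℝ))} {δ : ℝ} (hδ : 0 ≤ δ)
    (hπ : ∫⁻ x, costQ q x.1 x.2 ∂π ≤ ENNReal.ofReal δ) :
    ∫ x, (∑ i, φ i * (x.1 - x.2) i) ^ 2 ∂π ≤ (√δ * lpNorm p φ) ^ 2 := by
  rw [integral_eq_lintegral_of_nonneg_ae (ae_of_all _ fun x => sq_nonneg _)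
    (by fun_prop)]
  refine ENNReal.toReal_le_of_le_ofReal (sq_nonneg _) ?_
  calc ∫⁻ x, ENNReal.ofReal ((∑ i, φ i * (x.1 - x.2) i) ^ 2) ∂π
      ≤ ∫⁻ x, ENNReal.ofReal (lpNorm p φ ^ 2) * costQ q x.1 x.2 ∂π := by
        refine lintegral_mono fun x => ?_
        rw [costQ, ← ENNReal.ofReal_mul (sq_nonneg _), ← mul_pow]
        exact ENNReal.ofReal_le_ofReal
          (sq_le_sq' (neg_le_of_abs_le (hpq.abs_sum_mul_le φ _))
            (le_of_abs_le (hpq.abs_sum_mul_le φ _)))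
    _ = ENNReal.ofReal (lpNorm p φ ^ 2) * ∫⁻ x, costQ q x.1 x.2 ∂π := by
        rw [lintegral_const_mul' _ _ ENNReal.ofReal_ne_top]
    _ ≤ ENNReal.ofReal (lpNorm p φ ^ 2) * ENNReal.ofReal δ := by gcongr
    _ = ENNReal.ofReal ((√δ * lpNorm p φ) ^ 2) := by
        rw [← ENNReal.ofReal_mul (sq_nonneg _), mul_pow, Real.sq_sqrt hδ, mul_comm]

lemma HolderConjugate.variance_le_of_coupling (hpq : HolderConjugate q p)
    (φ : Fin d → ℝ) {P Q : Measure (Fin d → ℝ)} (hP : Integrable (fun r => ‖r‖ ^ 2) P)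
    (hQ : Integrable (fun r => ‖r‖ ^ 2) Q) {π : Measure ((Fin d → ℝ) × (Fin d → ℝ))}
    [IsProbabilityMeasure π] (h1 : π.map Prod.fst = P) (h2 : π.map Prod.snd = Q) {δ : ℝ}
    (hδ : 0 ≤ δ) (hπ : ∫⁻ x, costQ q x.1 x.2 ∂π ≤ ENNReal.ofReal δ) :
    variance (fun r : Fin d → ℝ => ∑ i, φ i * r i) P ≤
      (√(variance (fun r : Fin d → ℝ => ∑ i, φ i * r i) Q) + √δ * lpNorm p φ) ^ 2 := by
  have hX := memLp_two_sum_mul hP φ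
  have hY := memLp_two_sum_mul hQ φ
  subst h1 h2
  rw [memLp_map_measure_iff hX.1 (by fun_prop)] at hX
  rw [memLp_map_measure_iff hY.1 (by fun_prop)] at hY
  rw [variance_map (Measurable.aemeasurable (by fun_prop)) (by fun_prop),
    variance_map (Measurable.aemeasurable (by fun_prop)) (by fun_prop)]
  set L : (Fin d → ℝ) → ℝ := fun r => ∑ i, φ i * r i with hL
  have hZ := hX.sub hY
  have hZvar : variance (L ∘ Prod.fst - L ∘ Prod.snd) π ≤ (√δ * lpNorm p φ) ^ 2 := by
    refine (variance_le_expectation_sq hZ.1).trans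
      (le_of_eq_of_le ?_ (hpq.integral_sq_le φ hδ hπ))
    simp [hL, mul_sub]
  have h := variance_add_le_sq_sqrt_add_sqrt hY hZ
  rw [add_sub_cancel] at h
  have hN : 0 ≤ √δ * lpNorm p φ := mul_nonneg (Real.sqrt_nonneg _) (_root_.lpNorm_nonneg _ _)
  refine h.trans ?_
  gcongr
  exact (Real.sqrt_le_left hN).2 hZvar

lemma HolderConjugate.variance_le_of_Dc_le (hpq : HolderConjugate q p)
    (φ : Fin d → ℝ) {P Q : Measure (Fin d → ℝ)} (hP : Integrable (fun r => ‖r‖ ^ 2) P)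
    (hQ : Integrable (fun r => ‖r‖ ^ 2) Q) {δ : ℝ} (hδ : 0 ≤ δ)
    (hD : Dc (costQ q) P Q ≤ ENNReal.ofReal δ) :
    variance (fun r : Fin d → ℝ => ∑ i, φ i * r i) P ≤
      (√(variance (fun r : Fin d → ℝ => ∑ i, φ i * r i) Q) + √δ * lpNorm p φ) ^ 2 := by
  have hlim : Tendsto (fun ε : ℝ =>
      (√(variance (fun r : Fin d → ℝ => ∑ i, φ i * r i) Q) + √ε * lpNorm p φ) ^ 2) (𝓝[>] δ)
      (𝓝 ((√(variance (fun r : Fin d → ℝ => ∑ i, φ i * r i) Q) + √δ * lpNorm p φ) ^ 2)) :=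
    (Continuous.tendsto (by fun_prop) δ).mono_left nhdsWithin_le_nhds
  refine ge_of_tendsto hlim ?_
  filter_upwards [self_mem_nhdsWithin] with ε hε
  have hlt : Dc (costQ q) P Q < ENNReal.ofReal ε :=
    hD.trans_lt ((ENNReal.ofReal_lt_ofReal_iff (hδ.trans_lt hε)).2 hε)
  simp only [Dc, iInf_lt_iff] at hlt
  obtain ⟨π, _, h1, h2, hπ⟩ := hlt
  exact hpq.variance_le_of_coupling φ hP hQ h1 h2 (hδ.trans hε.le) hπ.le

lemma variance_uniformDirac {ι : Type*} [Fintype ι] [Nonempty ι] (x : ι → Fin d → ℝ)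
    (φ : Fin d → ℝ) :
    variance (fun r : Fin d → ℝ => ∑ i, φ i * r i) (uniformDirac x) =
      (Fintype.card ι : ℝ)⁻¹ * ∑ k, (∑ j, φ j * x k j) ^ 2 -
        ((Fintype.card ι : ℝ)⁻¹ * ∑ k, ∑ j, φ j * x k j) ^ 2 := by
  rw [variance_eq_sub (memLp_two_sum_mul (integrable_uniformDirac x _) φ)]
  simp_rw [Pi.pow_apply]
  rw [integral_uniformDirac, integral_uniformDirac]

lemma HolderConjugate.exists_variance_eq [Nonempty (Fin d)] {ι : Type*} [Fintype ι] [Nonempty ι]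
    (hpq : HolderConjugate q p) (hq : 1 ≤ q) (φ : Fin d → ℝ) (x : ι → Fin d → ℝ) {δ : ℝ}
    (hδ : 0 ≤ δ) :
    ∃ z : ι × Bool → Fin d → ℝ,
      Dc (costQ q) (uniformDirac z) (uniformDirac x) ≤ ENNReal.ofReal δ ∧
      variance (fun r : Fin d → ℝ => ∑ i, φ i * r i) (uniformDirac z) =
        (√(variance (fun r : Fin d → ℝ => ∑ i, φ i * r i) (uniformDirac x)) +
          √δ * lpNorm p φ) ^ 2 := by
  obtain ⟨v, hv, hφv⟩ := hpq.exists_sum_mul_eq_lpNorm φ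
  set y : ι → ℝ := fun i => ∑ j, φ j * x i j with hy
  obtain ⟨t, ht, ht2, hty⟩ := exists_perfectly_correlated y hδ
  have hc : (Fintype.card ι : ℝ) ≠ 0 := by simp
  refine ⟨fun k => x k.1 + t k • v, ?_, ?_⟩
  · refine (iInf_le_of_le (uniformDirac fun k : ι × Bool => (x k.1 + t k • v, x k.1)) <|
      iInf_le_of_le (inferInstance : IsProbabilityMeasure (uniformDirac _)) <|
      iInf_le_of_le (map_uniformDirac _ measurable_fst) <|
      iInf_le_of_le ?_ le_rfl).trans ?_
    · rw [map_uniformDirac _ measurable_snd]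
      exact uniformDirac_comp_fst x
    · rw [lintegral_uniformDirac]
      have hle : ∀ k : ι × Bool, costQ q (x k.1 + t k • v) (x k.1) ≤ ENNReal.ofReal (t k ^ 2) := by
        intro k
        refine ENNReal.ofReal_le_ofReal ?_
        rw [add_sub_cancel_left, lpNorm_smul (by linarith), mul_pow, sq_abs]
        exact mul_le_of_le_one_right (sq_nonneg _)
          (pow_le_one₀ (_root_.lpNorm_nonneg _ _) hv)
      refine (mul_le_mul_right (Finset.sum_le_sum fun k _ => hle k) _).trans ?_
      rw [← ENNReal.ofReal_sum_of_nonneg fun k _ => sq_nonneg _, ht2,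
        ← ENNReal.ofReal_natCast, ← ENNReal.ofReal_inv_of_pos (by simp [Fintype.card_pos]),
        ← ENNReal.ofReal_mul (by positivity)]
      refine ENNReal.ofReal_le_ofReal (le_of_eq ?_)
      simp
      field_simp
  · have hsum : ∀ k : ι × Bool, ∑ j, φ j * (x k.1 + t k • v) j = y k.1 + t k * lpNorm p φ := by
      intro k
      simp only [Pi.add_apply, Pi.smul_apply, smul_eq_mul, mul_add, Finset.sum_add_distrib, hy,
        ← hφv, Finset.mul_sum]
      congr 1
      exact Finset.sum_congr rfl fun j _ => by ring
    have hS := variance_uniformDirac x φ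
    have hS0 := Real.sq_sqrt (variance_nonneg (fun r : Fin d → ℝ => ∑ i, φ i * r i)
      (uniformDirac x))
    have hδ2 := Real.sq_sqrt hδ
    rw [← hS] at hty
    rw [variance_uniformDirac]
    simp_rw [hsum]
    have hexp : ∀ k : ι × Bool, (y k.1 + t k * lpNorm p φ) ^ 2 =
        y k.1 ^ 2 + 2 * lpNorm p φ * (t k * y k.1) + lpNorm p φ ^ 2 * t k ^ 2 :=
      fun k => by ring
    simp_rw [hexp, Finset.sum_add_distrib, ← Finset.mul_sum, ← Finset.sum_mul, ht, ht2, hty,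
      sum_prod_bool_fst (fun i => y i ^ 2), sum_prod_bool_fst y]
    rw [add_sq, hS0, mul_pow (√δ), hδ2]
    generalize √(variance _ _) = s at *
    rw [hS]
    simp only [Fintype.card_prod, Fintype.card_bool, Nat.cast_mul, Nat.cast_ofNat]
    field_simp
    ring

lemma HolderConjugate.worstVar_eq [Nonempty (Fin d)] (hn : 0 < n) (hpq : HolderConjugate q p)
    (hq : 1 ≤ q) (R : Fin n → Fin d → ℝ) {δ : ℝ} (hδ : 0 ≤ δ) (φ : Fin d → ℝ) :
    (⨆ (P : Measure (Fin d → ℝ)) (_ : IsProbabilityMeasure P)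
        (_ : Integrable (fun r => ‖r‖ ^ 2) P)
        (_ : Dc (costQ q) P (empMeasure R) ≤ ENNReal.ofReal δ),
        (((∫ r, (∑ i, φ i * r i) ^ 2 ∂P) - (∫ r, ∑ i, φ i * r i ∂P) ^ 2 : ℝ) : EReal)) =
      (((√((1 / n : ℝ) * (∑ i, (∑ j, φ j * R i j) ^ 2) -
          ((1 / n : ℝ) * ∑ i, ∑ j, φ j * R i j) ^ 2) + √δ * lpNorm p φ) ^ 2 : ℝ) : EReal) := by
  have : Nonempty (Fin n) := ⟨⟨0, hn⟩⟩
  have hV := variance_uniformDirac R φ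
  rw [Fintype.card_fin, ← one_div] at hV
  have hvar : ∀ (P : Measure (Fin d → ℝ)) [IsProbabilityMeasure P],
      Integrable (fun r => ‖r‖ ^ 2) P → (∫ r, (∑ i, φ i * r i) ^ 2 ∂P) -
        (∫ r, ∑ i, φ i * r i ∂P) ^ 2 = variance (fun r : Fin d → ℝ => ∑ i, φ i * r i) P :=
    fun P _ hP => (variance_eq_sub (memLp_two_sum_mul hP φ)).symm
  rw [empMeasure_eq_uniformDirac, ← hV]
  apply le_antisymm
  · refine iSup_le fun P => iSup_le fun _ => iSup_le fun hP => iSup_le fun hD => ?_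
    rw [hvar P hP]
    exact EReal.coe_le_coe_iff.2
      (hpq.variance_le_of_Dc_le φ hP (integrable_uniformDirac R _) hδ hD)
  · obtain ⟨z, hz, hzvar⟩ := hpq.exists_variance_eq hq φ R hδ
    have hP := integrable_uniformDirac z fun r => ‖r‖ ^ 2
    refine le_iSup_of_le (uniformDirac z) <| le_iSup_of_le inferInstance <|
      le_iSup_of_le hP <| le_iSup_of_le hz ?_
    rw [hvar _ hP, hzvar]

end WorstCaseVariance

/-- The distributionally robust mean–variance problem and the
regularized empirical problem have the same optimal value, and the same optimal
solutions over the feasible region `F_{δ,ᾱ}(n)`. -/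
theorem stmt8 {d n : ℕ} (hn : 0 < n) (q : ℝ) (hq : 1 ≤ q) (p : ℝ≥0∞)
    (hpq : HolderConjugate q p) (R : Fin n → Fin d → ℝ) (δ : ℝ) (hδ : 0 < δ) (ab : ℝ)
    (F : Set (Fin d → ℝ))
    (hF : F = {φ | ∑ i, φ i = 1 ∧
        (1 / n : ℝ) * ∑ i, ∑ j, φ j * R i j ≥ ab + Real.sqrt δ * lpNorm p φ})
    (worstVar : (Fin d → ℝ) → EReal)
    (hworstVar : worstVar = fun φ =>
      ⨆ (P : Measure (Fin d → ℝ)) (_ : IsProbabilityMeasure P)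
        (_ : Integrable (fun r => ‖r‖ ^ 2) P)
        (_ : Dc (costQ q) P (empMeasure R) ≤ ENNReal.ofReal δ),
        (((∫ r, (∑ i, φ i * r i) ^ 2 ∂P) - (∫ r, ∑ i, φ i * r i ∂P) ^ 2 : ℝ) : EReal))
    (g : (Fin d → ℝ) → ℝ)
    (hg : g = fun φ =>
      (Real.sqrt ((1 / n : ℝ) * (∑ i, (∑ j, φ j * R i j) ^ 2) -
          ((1 / n : ℝ) * ∑ i, ∑ j, φ j * R i j) ^ 2) +
        Real.sqrt δ * lpNorm p φ) ^ 2) :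
    (⨅ φ ∈ F, worstVar φ) = (⨅ φ ∈ F, ((g φ : ℝ) : EReal)) ∧
      ∀ φ ∈ F, ((∀ ψ ∈ F, worstVar φ ≤ worstVar ψ) ↔ (∀ ψ ∈ F, g φ ≤ g ψ)) := by
  have key : ∀ φ ∈ F, worstVar φ = ((g φ : ℝ) : EReal) := by
    intro φ hφ
    have : Nonempty (Fin d) := by
      by_contra hd
      rw [not_nonempty_iff] at hd
      simp [hF] at hφ
    rw [hworstVar, hg]
    exact hpq.worstVar_eq hn hq R hδ.le φ
  refine ⟨iInf_congr fun φ => iInf_congr fun hφ => key φ hφ, fun φ hφ => forall₂_congr fun ψ hψ => ?_⟩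
  rw [key φ hφ, key ψ hψ, EReal.coe_le_coe_iff]
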